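/- Let (Xⁿ, ω) be Kähler–Einstein with Ric_ω = −(n+1)ω and φ : X → ℝ with i∂∂̄φ = (n+1)ω and ‖∂φ‖_ω ≡ C constant. If ∂φ is not identically zero, then C ≥ n+1. -/

import Mathlib

noncomputable section

open Complex BigOperators
open scoped ComplexOrder

variable {n : ℕ}

/-- Wirtinger derivative `∂f/∂zᵅ` of `f : ℂⁿ → ℂ` at `x`. -/
def wdz (α : Fin n) (f : (Fin n → ℂ) → ℂ) (x : Fin n → ℂ) : ℂ :=
  (fderiv ℝ f x (Pi.single α 1) - Complex.I * fderiv ℝ f x (Pi.single α Complex.I)) / 2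

/-- Wirtinger derivative `∂f/∂z̄ᵅ` of `f : ℂⁿ → ℂ` at `x`. -/
def wdzbar (α : Fin n) (f : (Fin n → ℂ) → ℂ) (x : Fin n → ℂ) : ℂ :=
  (fderiv ℝ f x (Pi.single α 1) + Complex.I * fderiv ℝ f x (Pi.single α Complex.I)) / 2

-- A Hermitian metric is given by its matrix of components `g x α β = g_{α β̄}(x)`.
variable (g : (Fin n → ℂ) → Matrix (Fin n) (Fin n) ℂ)

/-- Christoffel symbols `Γ^β_{αλ} = g^{δ̄β} ∂_α g_{λδ̄}` of the Kähler (Chern) connection;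
`(g x)⁻¹ δ β` represents `g^{δ̄β}`. -/
def christoffel (β α lam : Fin n) (x : Fin n → ℂ) : ℂ :=
  ∑ δ, wdz α (fun y => g y lam δ) x * (g x)⁻¹ δ β

/-- Curvature tensor `R^β_{αλμ̄} = −∂_μ̄ Γ^β_{αλ}`, with the convention
`(∇_λ∇_μ̄ − ∇_μ̄∇_λ)∂_α = R^β_{αλμ̄} ∂_β`. -/
def curvature (β α lam μ : Fin n) (x : Fin n → ℂ) : ℂ :=
  - wdzbar μ (fun y => christoffel g β α lam y) x

variable (φ : (Fin n → ℂ) → ℝ)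

/-- `φ_α = ∂φ/∂zᵅ`. -/
def dphi (α : Fin n) (x : Fin n → ℂ) : ℂ := wdz α (fun y => (φ y : ℂ)) x

/-- `φ_ᾱ = ∂φ/∂z̄ᵅ`. -/
def dphibar (α : Fin n) (x : Fin n → ℂ) : ℂ := wdzbar α (fun y => (φ y : ℂ)) x

/-- The covariant `(2,0)`-Hessian `φ_{α;β} = ∂_β φ_α − Γ^γ_{αβ} φ_γ`. -/
def hess20 (α β : Fin n) (x : Fin n → ℂ) : ℂ :=
  wdz β (fun y => dphi φ α y) x - ∑ γ, christoffel g γ α β x * dphi φ γ x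

/-- The squared length `u = ‖∂φ‖²_ω = φ_α φ_β̄ g^{β̄α}` of the `(1,0)`-differential of `φ`. -/
def gradNormSq (x : Fin n → ℂ) : ℂ :=
  ∑ α, ∑ β, dphi φ α x * (starRingEnd ℂ) (dphi φ β x) * (g x)⁻¹ β α

/-- The `(1,0)`-gradient `grad(φ)^α = g^{β̄α} φ_β̄`. -/
def gradUp (α : Fin n) (x : Fin n → ℂ) : ℂ :=
  ∑ β, (g x)⁻¹ β α * (starRingEnd ℂ) (dphi φ β x)

/-- The Laplace–Beltrami operator `Δ_ω u = g^{β̄α} ∂_α ∂_β̄ u` on functions. -/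
def lapBeltrami (u : (Fin n → ℂ) → ℂ) (x : Fin n → ℂ) : ℂ :=
  ∑ α, ∑ β, (g x)⁻¹ β α * wdz α (fun y => wdzbar β u y) x

/-- `‖∇'²φ‖²_ω = φ_{α;β} φ^{α;β} = φ_{α;β} conj(φ_{γ;δ}) g^{γ̄α} g^{δ̄β}`. -/
def hessNormSq (x : Fin n → ℂ) : ℂ :=
  ∑ α, ∑ β, ∑ γ, ∑ δ,
    hess20 g φ α β x * (starRingEnd ℂ) (hess20 g φ γ δ x) * (g x)⁻¹ γ α * (g x)⁻¹ δ β

section helpers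

open scoped Matrix MatrixOrder

theorem wdz_mul' {f k : (Fin n → ℂ) → ℂ} {x : Fin n → ℂ} (α : Fin n)
    (hf : DifferentiableAt ℝ f x) (hk : DifferentiableAt ℝ k x) :
    wdz α (fun y => f y * k y) x = wdz α f x * k x + f x * wdz α k x := by
  unfold wdz
  rw [fderiv_fun_mul hf hk]
  simp
  ring

theorem wdzbar_mul' {f k : (Fin n → ℂ) → ℂ} {x : Fin n → ℂ} (α : Fin n)
    (hf : DifferentiableAt ℝ f x) (hk : DifferentiableAt ℝ k x) :
    wdzbar α (fun y => f y * k y) x = wdzbar α f x * k x + f x * wdzbar α k x := by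
  unfold wdzbar
  rw [fderiv_fun_mul hf hk]
  simp
  ring

theorem wdz_sum' {f : Fin n → (Fin n → ℂ) → ℂ} {x : Fin n → ℂ} (α : Fin n)
    (hf : ∀ i, DifferentiableAt ℝ (f i) x) :
    wdz α (fun y => ∑ i, f i y) x = ∑ i, wdz α (f i) x := by
  unfold wdz
  rw [fderiv_fun_sum (fun i _ => hf i)]
  simp only [sum_apply, Finset.mul_sum, ← Finset.sum_sub_distrib,
    Finset.sum_div]

theorem wdzbar_sum' {f : Fin n → (Fin n → ℂ) → ℂ} {x : Fin n → ℂ} (α : Fin n)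
    (hf : ∀ i, DifferentiableAt ℝ (f i) x) :
    wdzbar α (fun y => ∑ i, f i y) x = ∑ i, wdzbar α (f i) x := by
  unfold wdzbar
  rw [fderiv_fun_sum (fun i _ => hf i)]
  simp only [sum_apply, Finset.mul_sum, ← Finset.sum_add_distrib,
    Finset.sum_div]

theorem wdzbar_sub' {f k : (Fin n → ℂ) → ℂ} {x : Fin n → ℂ} (α : Fin n)
    (hf : DifferentiableAt ℝ f x) (hk : DifferentiableAt ℝ k x) :
    wdzbar α (fun y => f y - k y) x = wdzbar α f x - wdzbar α k x := by
  unfold wdzbar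
  rw [fderiv_fun_sub hf hk]
  simp
  ring

theorem wdz_congr' {U : Set (Fin n → ℂ)} (hU : IsOpen U) {f k : (Fin n → ℂ) → ℂ}
    {x : Fin n → ℂ} (hx : x ∈ U) (α : Fin n) (h : ∀ y ∈ U, f y = k y) :
    wdz α f x = wdz α k x := by
  unfold wdz
  rw [Filter.EventuallyEq.fderiv_eq (Filter.eventuallyEq_of_mem (hU.mem_nhds hx) h)]

theorem wdzbar_congr' {U : Set (Fin n → ℂ)} (hU : IsOpen U) {f k : (Fin n → ℂ) → ℂ}
    {x : Fin n → ℂ} (hx : x ∈ U) (α : Fin n) (h : ∀ y ∈ U, f y = k y) :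
    wdzbar α f x = wdzbar α k x := by
  unfold wdzbar
  rw [Filter.EventuallyEq.fderiv_eq (Filter.eventuallyEq_of_mem (hU.mem_nhds hx) h)]

theorem wdz_const' (c : ℂ) (x : Fin n → ℂ) (α : Fin n) : wdz α (fun _ => c) x = 0 := by
  simp [wdz]

theorem wdzbar_const' (c : ℂ) (x : Fin n → ℂ) (α : Fin n) : wdzbar α (fun _ => c) x = 0 := by
  simp [wdzbar]

theorem fderiv_conj' (f : (Fin n → ℂ) → ℂ) (x v : Fin n → ℂ) :
    fderiv ℝ (fun y => (starRingEnd ℂ) (f y)) x v = (starRingEnd ℂ) (fderiv ℝ f x v) := by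
  have := Complex.conjCLE.comp_fderiv (f := f) (x := x)
  have h2 : (fun y => (starRingEnd ℂ) (f y)) = Complex.conjCLE ∘ f := by
    ext y; simp
  rw [h2, this]; simp

theorem wdz_conj' (f : (Fin n → ℂ) → ℂ) (x : Fin n → ℂ) (α : Fin n) :
    wdz α (fun y => (starRingEnd ℂ) (f y)) x = (starRingEnd ℂ) (wdzbar α f x) := by
  simp [wdz, wdzbar, fderiv_conj', Complex.conj_ofNat]
  ring

theorem wdzbar_conj' (f : (Fin n → ℂ) → ℂ) (x : Fin n → ℂ) (α : Fin n) :
    wdzbar α (fun y => (starRingEnd ℂ) (f y)) x = (starRingEnd ℂ) (wdz α f x) := by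
  simp [wdz, wdzbar, fderiv_conj', Complex.conj_ofNat]

theorem smooth_fderiv' {U : Set (Fin n → ℂ)} (hU : IsOpen U) {f : (Fin n → ℂ) → ℂ}
    (hf : ContDiffOn ℝ (⊤ : ℕ∞) f U) (v : Fin n → ℂ) :
    ContDiffOn ℝ (⊤ : ℕ∞) (fun y => fderiv ℝ f y v) U :=
  (hf.fderiv_of_isOpen hU (by simp)).clm_apply contDiffOn_const

theorem smooth_wdz' {U : Set (Fin n → ℂ)} (hU : IsOpen U) {f : (Fin n → ℂ) → ℂ}
    (hf : ContDiffOn ℝ (⊤ : ℕ∞) f U) (α : Fin n) :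
    ContDiffOn ℝ (⊤ : ℕ∞) (fun y => wdz α f y) U := by
  unfold wdz
  exact ((smooth_fderiv' hU hf _).sub (contDiffOn_const.mul (smooth_fderiv' hU hf _))).div_const _

theorem smooth_wdzbar' {U : Set (Fin n → ℂ)} (hU : IsOpen U) {f : (Fin n → ℂ) → ℂ}
    (hf : ContDiffOn ℝ (⊤ : ℕ∞) f U) (α : Fin n) :
    ContDiffOn ℝ (⊤ : ℕ∞) (fun y => wdzbar α f y) U := by
  unfold wdzbar
  exact ((smooth_fderiv' hU hf _).add (contDiffOn_const.mul (smooth_fderiv' hU hf _))).div_const _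

theorem smooth_diffAt {U : Set (Fin n → ℂ)} (hU : IsOpen U) {f : (Fin n → ℂ) → ℂ}
    (hf : ContDiffOn ℝ (⊤ : ℕ∞) f U) {x : Fin n → ℂ} (hx : x ∈ U) :
    DifferentiableAt ℝ f x :=
  (hf.contDiffAt (hU.mem_nhds hx)).differentiableAt (by simp)

theorem fderiv2_symm' {U : Set (Fin n → ℂ)} (hU : IsOpen U) {f : (Fin n → ℂ) → ℂ}
    (hf : ContDiffOn ℝ (⊤ : ℕ∞) f U) {x : Fin n → ℂ} (hx : x ∈ U) (v w : Fin n → ℂ) :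
    fderiv ℝ (fun y => fderiv ℝ f y v) x w = fderiv ℝ (fun y => fderiv ℝ f y w) x v := by
  have hd : DifferentiableAt ℝ (fderiv ℝ f) x :=
    ((hf.fderiv_of_isOpen (m := (⊤ : ℕ∞)) hU (by simp)).contDiffAt
      (hU.mem_nhds hx)).differentiableAt (by simp)
  have hs := (hf.contDiffAt (hU.mem_nhds hx)).isSymmSndFDerivAt (by
    simp only [minSmoothness_of_isRCLikeNormedField]; exact WithTop.coe_le_coe.mpr (le_top : (2 : ℕ∞) ≤ ⊤))
  have key : ∀ v w, fderiv ℝ (fun y => fderiv ℝ f y v) x w = fderiv ℝ (fderiv ℝ f) x w v := by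
    intro v w
    rw [fderiv_clm_apply hd (differentiableAt_const v)]
    simp
  rw [key, key]
  exact hs w v

theorem wdz_comm' {U : Set (Fin n → ℂ)} (hU : IsOpen U) {f : (Fin n → ℂ) → ℂ}
    (hf : ContDiffOn ℝ (⊤ : ℕ∞) f U) {x : Fin n → ℂ} (hx : x ∈ U) (α β : Fin n) :
    wdzbar β (fun y => wdz α f y) x = wdz α (fun y => wdzbar β f y) x := by
  have hd : ∀ v, DifferentiableAt ℝ (fun y => fderiv ℝ f y v) x := fun v =>
    smooth_diffAt hU (smooth_fderiv' hU hf v) hx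
  have e1 : ∀ v, fderiv ℝ (fun y => wdz α f y) x v =
      (fderiv ℝ (fun y => fderiv ℝ f y (Pi.single α 1)) x v
        - Complex.I * fderiv ℝ (fun y => fderiv ℝ f y (Pi.single α Complex.I)) x v) / 2 := by
    intro v
    have := ((hd (Pi.single α 1)).hasFDerivAt.sub
      ((hd (Pi.single α Complex.I)).hasFDerivAt.const_mul Complex.I)).mul_const (2⁻¹ : ℂ)
    have h2 := this.fderiv
    have h3 : (fun y => wdz α f y) = fun y => (fderiv ℝ f y (Pi.single α 1)
        - Complex.I * fderiv ℝ f y (Pi.single α Complex.I)) * 2⁻¹ := by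
      ext y; simp [wdz, div_eq_mul_inv]
    rw [h3]
    erw [h2]
    simp
    ring
  have e2 : ∀ v, fderiv ℝ (fun y => wdzbar β f y) x v =
      (fderiv ℝ (fun y => fderiv ℝ f y (Pi.single β 1)) x v
        + Complex.I * fderiv ℝ (fun y => fderiv ℝ f y (Pi.single β Complex.I)) x v) / 2 := by
    intro v
    have := ((hd (Pi.single β 1)).hasFDerivAt.add
      ((hd (Pi.single β Complex.I)).hasFDerivAt.const_mul Complex.I)).mul_const (2⁻¹ : ℂ)
    have h2 := this.fderiv
    have h3 : (fun y => wdzbar β f y) = fun y => (fderiv ℝ f y (Pi.single β 1)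
        + Complex.I * fderiv ℝ f y (Pi.single β Complex.I)) * 2⁻¹ := by
      ext y; simp [wdzbar, div_eq_mul_inv]
    rw [h3]
    erw [h2]
    simp
    ring
  rw [wdzbar, wdz, e1, e1, e2, e2]
  rw [fderiv2_symm' hU hf hx (Pi.single β 1), fderiv2_symm' hU hf hx (Pi.single β 1),
    fderiv2_symm' hU hf hx (Pi.single β Complex.I), fderiv2_symm' hU hf hx (Pi.single β Complex.I)]
  ring

theorem smooth_det' {U : Set (Fin n → ℂ)} {m : ℕ}
    {A : (Fin n → ℂ) → Matrix (Fin m) (Fin m) ℂ}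
    (hA : ∀ i j, ContDiffOn ℝ (⊤ : ℕ∞) (fun y => A y i j) U) :
    ContDiffOn ℝ (⊤ : ℕ∞) (fun y => (A y).det) U := by
  simp only [Matrix.det_apply']
  refine ContDiffOn.sum fun σ _ => contDiffOn_const.mul ?_
  exact contDiffOn_prod fun i _ => hA _ _

theorem smooth_inv' {U : Set (Fin n → ℂ)}
    {A : (Fin n → ℂ) → Matrix (Fin n) (Fin n) ℂ}
    (hA : ∀ i j, ContDiffOn ℝ (⊤ : ℕ∞) (fun y => A y i j) U)
    (hdet : ∀ x ∈ U, (A x).det ≠ 0) (i j : Fin n) :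
    ContDiffOn ℝ (⊤ : ℕ∞) (fun y => (A y)⁻¹ i j) U := by
  simp only [Matrix.inv_def, Matrix.smul_apply, smul_eq_mul, Ring.inverse_eq_inv',
    Matrix.adjugate_apply]
  refine ((smooth_det' hA).inv hdet).mul (smooth_det' fun a b => ?_)
  simp only [Matrix.updateRow_apply]
  split_ifs
  · exact contDiffOn_const
  · exact hA _ _

theorem herm_nonneg' {h T : Matrix (Fin n) (Fin n) ℂ} (hh : h.PosSemidef) :
    0 ≤ ∑ α, ∑ β, ∑ γ, ∑ δ, T α β * (starRingEnd ℂ) (T γ δ) * h γ α * h δ β := by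
  have h1 : (T * hᵀ * Tᴴ).PosSemidef := hh.transpose.mul_mul_conjTranspose_same T
  obtain ⟨B, hB⟩ : ∃ B : Matrix (Fin n) (Fin n) ℂ, h = Bᴴ * B :=
    CStarAlgebra.nonneg_iff_eq_star_mul_self.mp hh.nonneg
  have h2 := (h1.mul_mul_conjTranspose_same B).trace_nonneg
  have h3 : (B * (T * hᵀ * Tᴴ) * Bᴴ).trace = (h * (T * hᵀ * Tᴴ)).trace := by
    rw [Matrix.trace_mul_comm, ← Matrix.mul_assoc, ← hB]
  rw [h3] at h2
  convert h2 using 1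
  simp only [Matrix.trace, Matrix.diag, Matrix.mul_apply, Finset.mul_sum, Finset.sum_mul,
    Matrix.transpose_apply, Matrix.conjTranspose_apply]
  symm
  rw [Finset.sum_comm]
  refine Finset.sum_congr rfl fun a _ => ?_
  rw [Finset.sum_comm]
  conv_rhs => rw [Finset.sum_comm]; enter [2, c]; rw [Finset.sum_comm]
  rw [Finset.sum_comm]
  refine Finset.sum_congr rfl fun a _ => ?_
  refine Finset.sum_congr rfl fun a _ => ?_
  refine Finset.sum_congr rfl fun a _ => ?_
  simp
  ring


theorem cancel_right' {G : Matrix (Fin n) (Fin n) ℂ} (hG : IsUnit G.det) {X Y : Fin n → ℂ}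
    (h : ∀ β, ∑ α, X α * G α β = ∑ α, Y α * G α β) : X = Y := by
  have h1 : Matrix.vecMul X G = Matrix.vecMul Y G := by
    ext β; simpa [Matrix.vecMul, dotProduct] using h β
  have h2 := congrArg (fun v => Matrix.vecMul v G⁻¹) h1
  simpa [Matrix.vecMul_vecMul, Matrix.mul_nonsing_inv _ hG] using h2

theorem quad_expand' (h H : Matrix (Fin n) (Fin n) ℂ) (hh : h.IsHermitian) (p V : Fin n → ℂ)
    (hV : ∀ α, V α = ∑ β, h β α * (starRingEnd ℂ) (p β)) (N c u : ℂ)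
    (hN : (starRingEnd ℂ) N = N) (hc : (starRingEnd ℂ) c = c) (hu' : (starRingEnd ℂ) u = u)
    (hu : ∑ α, p α * V α = u) (hHV : ∀ γ, ∑ α, V α * H α γ = -N * p γ) :
    ∑ α, ∑ β, ∑ γ, ∑ δ, (H α β + c * (p α * p β)) *
      (starRingEnd ℂ) (H γ δ + c * (p γ * p δ)) * h γ α * h δ β
    = ∑ α, ∑ β, ∑ γ, ∑ δ, H α β * (starRingEnd ℂ) (H γ δ) * h γ α * h δ β
      - 2 * c * N * u + c ^ 2 * u ^ 2 := by
  have hVc : ∀ γ, (starRingEnd ℂ) (V γ) = ∑ α, h γ α * p α := by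
    intro γ
    rw [hV, map_sum]
    refine Finset.sum_congr rfl fun α _ => ?_
    have := hh.apply γ α
    simp only [map_mul, Complex.conj_conj]
    rw [← this]; simp
  have e1 : ∑ α, ∑ β, ∑ γ, ∑ δ, H α β * (starRingEnd ℂ) (p γ * p δ) * h γ α * h δ β
      = -N * u := by
    calc _ = ∑ α, ∑ β, H α β * V α * V β := by
          refine Finset.sum_congr rfl fun α _ => Finset.sum_congr rfl fun β _ => ?_
          rw [hV α, hV β, mul_assoc, Finset.sum_mul_sum, Finset.mul_sum]
          refine Finset.sum_congr rfl fun γ _ => ?_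
          rw [Finset.mul_sum]
          refine Finset.sum_congr rfl fun δ _ => ?_
          simp only [map_mul]; ring
      _ = ∑ β, (∑ α, V α * H α β) * V β := by
          rw [Finset.sum_comm]
          refine Finset.sum_congr rfl fun β _ => ?_
          rw [Finset.sum_mul]
          refine Finset.sum_congr rfl fun α _ => ?_
          ring
      _ = _ := by
          rw [← hu, Finset.mul_sum]
          refine Finset.sum_congr rfl fun β _ => ?_
          rw [hHV]; ring
  have e2 : ∑ α, ∑ β, ∑ γ, ∑ δ, (p α * p β) * (starRingEnd ℂ) (H γ δ) * h γ α * h δ β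
      = -N * u := by
    have := congrArg (starRingEnd ℂ) e1
    simp only [map_mul, map_neg, hN, hu'] at this
    rw [← this]
    simp only [map_sum, map_mul, Complex.conj_conj]
    have hs : ∀ a b, (starRingEnd ℂ) (h a b) = h b a := fun a b => hh.apply b a
    simp only [hs]
    calc _ = ∑ α, ∑ γ, ∑ β, ∑ δ, p α * p β * (starRingEnd ℂ) (H γ δ) * h γ α * h δ β :=
          Finset.sum_congr rfl fun _ _ => Finset.sum_comm
      _ = ∑ γ, ∑ α, ∑ β, ∑ δ, p α * p β * (starRingEnd ℂ) (H γ δ) * h γ α * h δ β :=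
          Finset.sum_comm
      _ = ∑ γ, ∑ α, ∑ δ, ∑ β, p α * p β * (starRingEnd ℂ) (H γ δ) * h γ α * h δ β :=
          Finset.sum_congr rfl fun _ _ => Finset.sum_congr rfl fun _ _ => Finset.sum_comm
      _ = ∑ γ, ∑ δ, ∑ α, ∑ β, p α * p β * (starRingEnd ℂ) (H γ δ) * h γ α * h δ β :=
          Finset.sum_congr rfl fun _ _ => Finset.sum_comm
      _ = _ := by
          refine Finset.sum_congr rfl fun _ _ => Finset.sum_congr rfl fun _ _ =>
            Finset.sum_congr rfl fun _ _ => Finset.sum_congr rfl fun _ _ => ?_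
          ring
  have e3 : ∑ α, ∑ β, ∑ γ, ∑ δ, (p α * p β) * (starRingEnd ℂ) (p γ * p δ) * h γ α * h δ β
      = u ^ 2 := by
    rw [sq, ← hu, Finset.sum_mul_sum]
    refine Finset.sum_congr rfl fun α _ => Finset.sum_congr rfl fun β _ => ?_
    rw [hV α, hV β, mul_mul_mul_comm, Finset.sum_mul_sum, Finset.mul_sum]
    refine Finset.sum_congr rfl fun γ _ => ?_
    rw [Finset.mul_sum]
    refine Finset.sum_congr rfl fun δ _ => ?_
    simp only [map_mul]; ring
  have : ∀ α β γ δ, (H α β + c * (p α * p β)) *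
      (starRingEnd ℂ) (H γ δ + c * (p γ * p δ)) * h γ α * h δ β =
      H α β * (starRingEnd ℂ) (H γ δ) * h γ α * h δ β +
      c * (H α β * (starRingEnd ℂ) (p γ * p δ) * h γ α * h δ β) +
      c * ((p α * p β) * (starRingEnd ℂ) (H γ δ) * h γ α * h δ β) +
      c ^ 2 * ((p α * p β) * (starRingEnd ℂ) (p γ * p δ) * h γ α * h δ β) := by
    intro α β γ δ
    simp only [map_add, map_mul, hc]; ring
  simp only [this, Finset.sum_add_distrib, ← Finset.mul_sum]
  rw [e1, e2, e3]
  ring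

end helpers

/-- On a Kähler–Einstein manifold with `Ric_ω = −(n+1)ω`, if
`i∂∂̄φ = (n+1)ω`, `‖∂φ‖_ω ≡ C` is constant, and `∂φ` is not identically zero,
then `C ≥ n + 1`. -/
theorem constant_gradient_norm_lower_bound
    (U : Set (Fin n → ℂ)) (hU : IsOpen U)
    (hherm : ∀ x ∈ U, (g x).IsHermitian)
    (hpos : ∀ x ∈ U, (g x).PosDef)
    (hgsmooth : ∀ α β : Fin n, ContDiffOn ℝ (⊤ : ℕ∞) (fun y => g y α β) U)
    (hkahler : ∀ x ∈ U, ∀ α β γ : Fin n,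
      wdz γ (fun y => g y α β) x = wdz α (fun y => g y γ β) x)
    (hEinstein : ∀ x ∈ U, ∀ lam μ : Fin n,
      (∑ α, curvature g α α lam μ x) = -((n : ℂ) + 1) * g x lam μ)
    (hφsmooth : ContDiffOn ℝ (⊤ : ℕ∞) (fun y => (φ y : ℂ)) U)
    (hpot : ∀ x ∈ U, ∀ α β : Fin n,
      wdzbar β (fun y => dphi φ α y) x = ((n : ℂ) + 1) * g x α β)    (C : ℝ) (hC : 0 ≤ C)
    (hconst : ∀ x ∈ U, gradNormSq g φ x = (C : ℂ) ^ 2)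
    (hne : ∃ x ∈ U, ∃ α : Fin n, dphi φ α x ≠ 0) :
    (n : ℝ) + 1 ≤ C := by
  classical
  set N : ℂ := (n : ℂ) + 1 with hNdef
  have hNc : (starRingEnd ℂ) N = N := by simp [hNdef]
  have hunit : ∀ x ∈ U, IsUnit (g x).det := fun x hx => (hpos x hx).det_pos.ne'.isUnit
  have hdet : ∀ x ∈ U, (g x).det ≠ 0 := fun x hx => (hunit x hx).ne_zero
  have hinv : ∀ α β, ContDiffOn ℝ (⊤ : ℕ∞) (fun y => (g y)⁻¹ α β) U :=
    fun α β => smooth_inv' hgsmooth hdet α β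
  have hinvmul : ∀ x ∈ U, ∀ a b, ∑ k, (g x)⁻¹ a k * g x k b = if a = b then 1 else 0 := by
    intro x hx a b
    rw [← Matrix.mul_apply, Matrix.nonsing_inv_mul _ (hunit x hx), Matrix.one_apply]
  have hmulinv : ∀ x ∈ U, ∀ a b, ∑ k, g x a k * (g x)⁻¹ k b = if a = b then 1 else 0 := by
    intro x hx a b
    rw [← Matrix.mul_apply, Matrix.mul_nonsing_inv _ (hunit x hx), Matrix.one_apply]
  have hgc : ∀ x ∈ U, ∀ a b, (starRingEnd ℂ) (g x a b) = g x b a :=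
    fun x hx a b => (hherm x hx).apply b a
  have hp : ∀ α, ContDiffOn ℝ (⊤ : ℕ∞) (fun y => dphi φ α y) U :=
    fun α => smooth_wdz' hU hφsmooth α
  have hq : ∀ α, ContDiffOn ℝ (⊤ : ℕ∞) (fun y => (starRingEnd ℂ) (dphi φ α y)) U :=
    fun α => Complex.conjCLE.contDiff.comp_contDiffOn (hp α)
  have hV : ∀ α, ContDiffOn ℝ (⊤ : ℕ∞) (fun y => gradUp g φ α y) U :=
    fun α => ContDiffOn.sum fun β _ => (hinv _ _).mul (hq _)
  have hΓ : ∀ β α l, ContDiffOn ℝ (⊤ : ℕ∞) (fun y => christoffel g β α l y) U :=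
    fun β α l => ContDiffOn.sum fun δ _ => (smooth_wdz' hU (hgsmooth _ _) _).mul (hinv _ _)
  have hH : ∀ α β, ContDiffOn ℝ (⊤ : ℕ∞) (fun y => hess20 g φ α β y) U :=
    fun α β => (smooth_wdz' hU (hp _) _).sub
      (ContDiffOn.sum fun γ _ => (hΓ _ _ _).mul (hp _))
  -- Christoffel symbols contracted with the metric
  have F1 : ∀ x ∈ U, ∀ α l δ, ∑ β, christoffel g β α l x * g x β δ
      = wdz α (fun y => g y l δ) x := by
    intro x hx α l δ
    simp only [christoffel, Finset.sum_mul]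
    rw [Finset.sum_comm]
    simp only [mul_assoc, ← Finset.mul_sum, hinvmul x hx]
    simp
  have F2 : ∀ x ∈ U, ∀ β, ∑ α, gradUp g φ α x * g x α β = (starRingEnd ℂ) (dphi φ β x) := by
    intro x hx β
    simp only [gradUp, Finset.sum_mul]
    rw [Finset.sum_comm]
    have : ∀ a k, (g x)⁻¹ a k * (starRingEnd ℂ) (dphi φ a x) * g x k β =
      (starRingEnd ℂ) (dphi φ a x) * ((g x)⁻¹ a k * g x k β) := by intros; ring
    simp only [this, ← Finset.mul_sum, hinvmul x hx]
    simp
  have Γsymm : ∀ x ∈ U, ∀ β α l, christoffel g β α l x = christoffel g β l α x := by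
    intro x hx β α l
    simp only [christoffel]
    refine Finset.sum_congr rfl fun δ _ => ?_
    rw [hkahler x hx l δ α]
  have hu : ∀ x ∈ U, ∑ α, dphi φ α x * gradUp g φ α x = (C : ℂ) ^ 2 := by
    intro x hx
    rw [← hconst x hx]
    simp only [gradNormSq, gradUp, Finset.mul_sum]
    refine Finset.sum_congr rfl fun a _ => Finset.sum_congr rfl fun b _ => ?_
    ring
  have dq : ∀ x ∈ U, ∀ γ β, wdz γ (fun y => (starRingEnd ℂ) (dphi φ β y)) x = N * g x γ β := by
    intro x hx γ β
    rw [wdz_conj', hpot x hx, map_mul, hNc, hgc x hx]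
  have dV : ∀ x ∈ U, ∀ γ α, wdz γ (fun y => gradUp g φ α y) x =
      (if α = γ then N else 0) - ∑ ε, gradUp g φ ε x * christoffel g α γ ε x := by
    intro x hx γ
    refine congrFun (cancel_right' (hunit x hx) (X := fun α => wdz γ (fun y => gradUp g φ α y) x)
      (Y := fun α => (if α = γ then N else 0) - ∑ ε, gradUp g φ ε x * christoffel g α γ ε x) ?_)
    intro β
    have h1 := wdz_congr' hU hx γ (fun y hy => F2 y hy β)
    rw [dq x hx, wdz_sum' γ (fun α => smooth_diffAt hU ((hV α).mul (hgsmooth α β)) hx)] at h1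
    simp only [fun α => wdz_mul' γ (smooth_diffAt hU (hV α) hx)
      (smooth_diffAt hU (hgsmooth α β) hx)] at h1
    rw [Finset.sum_add_distrib] at h1
    rw [eq_sub_of_add_eq h1]
    simp only [sub_mul, Finset.sum_sub_distrib, ite_mul, zero_mul, Finset.sum_ite_eq',
      Finset.mem_univ, if_true, Finset.sum_mul]
    congr 1
    rw [Finset.sum_comm]
    refine Finset.sum_congr rfl fun ε _ => ?_
    rw [← F1 x hx, Finset.mul_sum]
    refine Finset.sum_congr rfl fun α _ => ?_
    ring
  have step1 : ∀ x ∈ U, ∀ γ, ∑ α, gradUp g φ α x * hess20 g φ α γ x = -N * dphi φ γ x := by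
    intro x hx γ
    have h1 := wdz_congr' hU hx γ hu
    rw [wdz_const', wdz_sum' γ (fun α => smooth_diffAt hU ((hp α).mul (hV α)) hx)] at h1
    simp only [fun α => wdz_mul' γ (smooth_diffAt hU (hp α) hx)
      (smooth_diffAt hU (hV α) hx), dV x hx, mul_sub, Finset.sum_add_distrib,
      Finset.sum_sub_distrib, mul_ite, mul_zero, Finset.sum_ite_eq',
      Finset.mem_univ, if_true] at h1
    simp only [hess20, mul_sub, Finset.sum_sub_distrib]
    have e1 : ∑ α, gradUp g φ α x * ∑ κ, christoffel g κ α γ x * dphi φ κ x =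
        ∑ α, dphi φ α x * ∑ ε, gradUp g φ ε x * christoffel g α γ ε x := by
      simp only [Finset.mul_sum]
      rw [Finset.sum_comm]
      refine Finset.sum_congr rfl fun a _ => Finset.sum_congr rfl fun b _ => ?_
      rw [Γsymm x hx]; ring
    have e2 : ∑ α, gradUp g φ α x * wdz γ (fun y => dphi φ α y) x =
        ∑ α, wdz γ (fun y => dphi φ α y) x * gradUp g φ α x :=
      Finset.sum_congr rfl fun a _ => mul_comm _ _
    rw [e1, e2]
    linear_combination h1
  have dgbar : ∀ x ∈ U, ∀ μ a b, wdzbar μ (fun y => g y a b) x =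
      (starRingEnd ℂ) (wdz μ (fun y => g y b a) x) := by
    intro x hx μ a b
    rw [← wdzbar_conj']
    exact wdzbar_congr' hU hx μ fun y hy => (hgc y hy b a).symm
  have kbar : ∀ x ∈ U, ∀ μ a b, wdzbar μ (fun y => g y a b) x = wdzbar b (fun y => g y a μ) x := by
    intro x hx μ a b
    rw [dgbar x hx, dgbar x hx, hkahler x hx]
  obtain ⟨x, hx, α₀, hα₀⟩ := hne
  -- the antiholomorphic derivative of the gradient
  have W : ∀ μ β, ∑ α, wdzbar μ (fun y => gradUp g φ α y) x * g x α β =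
      (starRingEnd ℂ) (hess20 g φ β μ x) := by
    intro μ β
    have h1 := wdzbar_congr' hU hx μ (fun y hy => F2 y hy β)
    rw [wdzbar_conj', wdzbar_sum' μ (fun α => smooth_diffAt hU ((hV α).mul (hgsmooth α β)) hx)] at h1
    simp only [fun α => wdzbar_mul' μ (smooth_diffAt hU (hV α) hx)
      (smooth_diffAt hU (hgsmooth α β) hx)] at h1
    rw [Finset.sum_add_distrib] at h1
    rw [eq_sub_of_add_eq h1, hess20, map_sub]
    congr 1
    simp only [map_sum, map_mul]
    simp only [← F2 x hx, Finset.mul_sum]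
    rw [Finset.sum_comm]
    refine Finset.sum_congr rfl fun a _ => ?_
    rw [dgbar x hx, hkahler x hx, ← F1 x hx, map_sum, Finset.mul_sum]
    refine Finset.sum_congr rfl fun b _ => ?_
    rw [map_mul, hgc x hx]; ring
  have W2 : ∀ μ α, wdzbar μ (fun y => gradUp g φ α y) x =
      ∑ δ, (starRingEnd ℂ) (hess20 g φ δ μ x) * (g x)⁻¹ δ α := by
    intro μ
    refine congrFun (cancel_right' (hunit x hx)
      (X := fun α => wdzbar μ (fun y => gradUp g φ α y) x)
      (Y := fun α => ∑ δ, (starRingEnd ℂ) (hess20 g φ δ μ x) * (g x)⁻¹ δ α) ?_)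
    intro β
    rw [W]
    simp only [Finset.sum_mul]
    rw [Finset.sum_comm]
    simp only [mul_assoc, ← Finset.mul_sum, hinvmul x hx]
    simp
  have dH : ∀ μ α γ, wdzbar μ (fun y => hess20 g φ α γ y) x =
      ∑ ε, curvature g ε α γ μ x * dphi φ ε x := by
    intro μ α γ
    have d1 := fun κ => smooth_diffAt hU ((hΓ κ α γ).mul (hp κ)) hx
    have d2 := smooth_diffAt hU (smooth_wdz' hU (hp α) γ) hx
    have d3 := smooth_diffAt hU
      (ContDiffOn.sum fun κ (_ : κ ∈ Finset.univ) => (hΓ κ α γ).mul (hp κ)) hx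
    simp only [hess20]
    rw [wdzbar_sub' μ d2 d3, wdzbar_sum' μ d1]
    simp only [fun κ => wdzbar_mul' μ (smooth_diffAt hU (hΓ κ α γ) hx)
      (smooth_diffAt hU (hp κ) hx), hpot x hx]
    rw [wdz_comm' hU (hp α) hx, wdz_congr' hU hx γ (fun y hy => hpot y hy α μ),
      wdz_mul' γ (differentiableAt_const _) (smooth_diffAt hU (hgsmooth α μ) hx), wdz_const',
      hkahler x hx α μ γ, ← F1 x hx, Finset.sum_add_distrib]
    have : ∑ κ, christoffel g κ α γ x * (N * g x κ μ) = N * ∑ κ, christoffel g κ α γ x * g x κ μ := by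
      rw [Finset.mul_sum]; exact Finset.sum_congr rfl fun _ _ => by ring
    rw [this]
    simp only [curvature, neg_mul, Finset.sum_neg_distrib]
    ring
  have step2 : ∀ γ μ, ∑ α, wdzbar μ (fun y => gradUp g φ α y) x * hess20 g φ α γ x +
      ∑ α, gradUp g φ α x * ∑ ε, curvature g ε α γ μ x * dphi φ ε x = -N ^ 2 * g x γ μ := by
    intro γ μ
    have h1 := wdzbar_congr' hU hx μ (fun y hy => step1 y hy γ)
    rw [wdzbar_sum' μ (fun α => smooth_diffAt hU ((hV α).mul (hH α γ)) hx),
      wdzbar_mul' μ (differentiableAt_const _) (smooth_diffAt hU (hp γ) hx), wdzbar_const',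
      hpot x hx] at h1
    simp only [fun α => wdzbar_mul' μ (smooth_diffAt hU (hV α) hx)
      (smooth_diffAt hU (hH α γ) hx), dH] at h1
    rw [Finset.sum_add_distrib] at h1
    rw [h1]; ring
  -- symmetries of the curvature
  have L : ∀ α γ μ ν, ∑ ε, curvature g ε α γ μ x * g x ε ν =
      ∑ ε, christoffel g ε α γ x * wdzbar μ (fun y => g y ε ν) x
        - wdz α (fun y => wdzbar μ (fun z => g z γ ν) y) x := by
    intro α γ μ ν
    have h1 := wdzbar_congr' hU hx μ (fun y hy => F1 y hy α γ ν)
    rw [wdz_comm' hU (hgsmooth γ ν) hx,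
      wdzbar_sum' μ (fun ε => smooth_diffAt hU ((hΓ ε α γ).mul (hgsmooth ε ν)) hx)] at h1
    simp only [fun ε => wdzbar_mul' μ (smooth_diffAt hU (hΓ ε α γ) hx)
      (smooth_diffAt hU (hgsmooth ε ν) hx)] at h1
    rw [Finset.sum_add_distrib] at h1
    rw [← h1]
    simp only [curvature, neg_mul, Finset.sum_neg_distrib]
    ring
  have Lsymm : ∀ α γ μ ν, ∑ ε, curvature g ε α γ μ x * g x ε ν =
      ∑ ε, curvature g ε α γ ν x * g x ε μ := by
    intro α γ μ ν
    rw [L, L, wdz_congr' hU hx α (fun y hy => kbar y hy μ γ ν)]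
    simp only [fun ε => kbar x hx μ ε ν]
  have Rsymm : ∀ ε α γ μ, curvature g ε α γ μ x = curvature g ε γ α μ x := by
    intro ε α γ μ
    simp only [curvature]
    rw [wdzbar_congr' hU hx μ (fun y hy => Γsymm y hy ε α γ)]
  have K : ∀ α ε, ∑ γ, ∑ μ, (g x)⁻¹ μ γ * curvature g ε α γ μ x = if ε = α then -N else 0 := by
    intro α
    refine congrFun (cancel_right' (hunit x hx)
      (X := fun ε => ∑ γ, ∑ μ, (g x)⁻¹ μ γ * curvature g ε α γ μ x)
      (Y := fun ε => if ε = α then -N else 0) ?_)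
    intro ν
    simp only [ite_mul, zero_mul, Finset.sum_ite_eq', Finset.mem_univ, if_true]
    rw [← hEinstein x hx α ν]
    simp only [Finset.sum_mul]
    rw [Finset.sum_comm]
    refine Finset.sum_congr rfl fun γ _ => ?_
    rw [Finset.sum_comm]
    simp only [mul_assoc, ← Finset.mul_sum]
    simp only [fun μ => Lsymm α γ μ ν, Finset.mul_sum]
    rw [Finset.sum_comm]
    have : ∀ ε μ, (g x)⁻¹ μ γ * (curvature g ε α γ ν x * g x ε μ) =
      curvature g ε α γ ν x * (g x ε μ * (g x)⁻¹ μ γ) := by intros; ring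
    simp only [this, ← Finset.mul_sum, hmulinv x hx]
    simp [Rsymm γ α γ ν]
  have trace : hessNormSq g φ x - N * (C : ℂ) ^ 2 = -N ^ 2 * n := by
    have h1 : ∑ γ, ∑ μ, (g x)⁻¹ μ γ * (∑ α, wdzbar μ (fun y => gradUp g φ α y) x * hess20 g φ α γ x +
      ∑ α, gradUp g φ α x * ∑ ε, curvature g ε α γ μ x * dphi φ ε x) =
      ∑ γ, ∑ μ, (g x)⁻¹ μ γ * (-N ^ 2 * g x γ μ) := by simp only [step2]
    have r : ∑ γ, ∑ μ, (g x)⁻¹ μ γ * (-N ^ 2 * g x γ μ) = -N ^ 2 * n := by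
      have : ∀ γ μ, (g x)⁻¹ μ γ * (-N ^ 2 * g x γ μ) = -N ^ 2 * (g x γ μ * (g x)⁻¹ μ γ) := by
        intros; ring
      simp only [this, ← Finset.mul_sum, hmulinv x hx]
      simp
    rw [r] at h1
    rw [← h1]
    simp only [mul_add, Finset.sum_add_distrib]
    rw [sub_eq_add_neg]
    congr 1
    · simp only [hessNormSq, W2, Finset.mul_sum, Finset.sum_mul]
      calc _ = ∑ β, ∑ α, ∑ γ, ∑ δ, hess20 g φ α β x * (starRingEnd ℂ) (hess20 g φ γ δ x) *
              (g x)⁻¹ γ α * (g x)⁻¹ δ β := Finset.sum_comm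
        _ = ∑ β, ∑ α, ∑ δ, ∑ γ, hess20 g φ α β x * (starRingEnd ℂ) (hess20 g φ γ δ x) *
              (g x)⁻¹ γ α * (g x)⁻¹ δ β :=
            Finset.sum_congr rfl fun _ _ => Finset.sum_congr rfl fun _ _ => Finset.sum_comm
        _ = ∑ β, ∑ δ, ∑ α, ∑ γ, hess20 g φ α β x * (starRingEnd ℂ) (hess20 g φ γ δ x) *
              (g x)⁻¹ γ α * (g x)⁻¹ δ β :=
            Finset.sum_congr rfl fun _ _ => Finset.sum_comm
        _ = _ := by
            refine Finset.sum_congr rfl fun _ _ => Finset.sum_congr rfl fun _ _ =>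
              Finset.sum_congr rfl fun _ _ => Finset.sum_congr rfl fun _ _ => ?_
            ring
    · have e : ∀ α ε, ∑ γ, ∑ μ, (g x)⁻¹ μ γ * (gradUp g φ α x * (curvature g ε α γ μ x * dphi φ ε x))
          = gradUp g φ α x * dphi φ ε x * (if ε = α then -N else 0) := by
        intro α ε
        rw [← K, Finset.mul_sum]
        refine Finset.sum_congr rfl fun _ _ => ?_
        rw [Finset.mul_sum]
        refine Finset.sum_congr rfl fun _ _ => ?_
        ring
      symm
      simp only [Finset.mul_sum]
      calc _ = ∑ γ, ∑ α, ∑ μ, ∑ ε, (g x)⁻¹ μ γ *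
              (gradUp g φ α x * (curvature g ε α γ μ x * dphi φ ε x)) :=
            Finset.sum_congr rfl fun _ _ => Finset.sum_comm
        _ = ∑ α, ∑ γ, ∑ μ, ∑ ε, (g x)⁻¹ μ γ *
              (gradUp g φ α x * (curvature g ε α γ μ x * dphi φ ε x)) := Finset.sum_comm
        _ = ∑ α, ∑ γ, ∑ ε, ∑ μ, (g x)⁻¹ μ γ *
              (gradUp g φ α x * (curvature g ε α γ μ x * dphi φ ε x)) :=
            Finset.sum_congr rfl fun _ _ => Finset.sum_congr rfl fun _ _ => Finset.sum_comm
        _ = ∑ α, ∑ ε, ∑ γ, ∑ μ, (g x)⁻¹ μ γ *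
              (gradUp g φ α x * (curvature g ε α γ μ x * dphi φ ε x)) :=
            Finset.sum_congr rfl fun _ _ => Finset.sum_comm
        _ = _ := by
            simp only [e]
            simp only [mul_ite, mul_zero, Finset.sum_ite_eq', Finset.mem_univ, if_true]
            rw [← hu x hx, Finset.mul_sum, ← Finset.sum_neg_distrib]
            exact Finset.sum_congr rfl fun _ _ => by ring
  have hCne : C ≠ 0 := by
    rintro rfl
    have h1 := step1 x hx α₀
    have hpd := (hpos x hx).inv
    have h2 := hu x hx
    by_contra _
    have hv : (fun α => (starRingEnd ℂ) (dphi φ α x)) ≠ 0 := by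
      intro h0
      exact hα₀ (by simpa using congrFun h0 α₀)
    have h3 := hpd.transpose.dotProduct_mulVec_pos hv
    have h4 : star (fun α => (starRingEnd ℂ) (dphi φ α x)) ⬝ᵥ
        (((g x)⁻¹).transpose.mulVec (fun α => (starRingEnd ℂ) (dphi φ α x))) = 0 := by
      rw [← show ((0 : ℝ) : ℂ) ^ 2 = 0 by simp, ← h2]
      simp [dotProduct, Matrix.mulVec, gradUp]
    exact h3.ne' h4
  have hCC : (C : ℂ) ≠ 0 := by exact_mod_cast hCne
  have hq := quad_expand' (g x)⁻¹ (fun α β => hess20 g φ α β x) (hherm x hx).inv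
    (fun α => dphi φ α x) (fun α => gradUp g φ α x) (fun α => rfl) N (N / (C : ℂ) ^ 2)
    ((C : ℂ) ^ 2) hNc (by simp [hNc]) (by simp) (hu x hx) (step1 x hx)
  have hnn := herm_nonneg' (T := fun α β => hess20 g φ α β x +
    N / (C : ℂ) ^ 2 * (dphi φ α x * dphi φ β x)) (hpos x hx).inv.posSemidef
  rw [hq] at hnn
  change 0 ≤ hessNormSq g φ x - _ + _ at hnn
  have hfin : hessNormSq g φ x - 2 * (N / (C : ℂ) ^ 2) * N * (C : ℂ) ^ 2 +
      (N / (C : ℂ) ^ 2) ^ 2 * ((C : ℂ) ^ 2) ^ 2 =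
      ((((n : ℝ) + 1) * (C ^ 2 - ((n : ℝ) + 1) ^ 2) : ℝ) : ℂ) := by
    have : hessNormSq g φ x = N * (C : ℂ) ^ 2 - N ^ 2 * n := by linear_combination trace
    rw [this]
    field_simp
    push_cast
    rw [← hNdef, show (n : ℂ) = N - 1 by rw [hNdef]; ring]
    ring
  rw [hfin] at hnn
  have hr : 0 ≤ ((n : ℝ) + 1) * (C ^ 2 - ((n : ℝ) + 1) ^ 2) := by exact_mod_cast hnn
  have hn1 : (0 : ℝ) < (n : ℝ) + 1 := by positivity
  have := nonneg_of_mul_nonneg_right hr hn1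
  nlinarith
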